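/- arXiv:2509.10770 — 2 statements merged into one kernel-verified Lean document; each statement's English description precedes it below -/
import Mathlib

section
/- (Remark 6: energy bound on the diffuse-coefficient estimate.) Let τ > 0, λ > 0, and let D ∈ ℂ^{N×L} be the diffuse basis matrix whose r-th column (r = 0, …, L−1) is (1/√N)·a(r/L). If (ĥ, ĉ) is a primal optimal solution of the HALS primal objective f, then ‖ĉ‖₂ ≤ √L · τ / λ. -/
open scoped BigOperators
open MeasureTheory

noncomputable section

/-- The vector `a(f) ∈ ℂ^N` with entries `a(f)_k = exp(2πi k f)`. -/
def aVec (N : ℕ) (f : ℝ) : Fin N → ℂ :=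
  fun k => Complex.exp (((2 * Real.pi * (k : ℕ) * f : ℝ) : ℂ) * Complex.I)

/-- The atomic set `A = {exp(2πi φ) a(f) : f ∈ [0,1], φ ∈ [0,1]}`. -/
def atomSet (N : ℕ) : Set (Fin N → ℂ) :=
  { x | ∃ f φ : ℝ, f ∈ Set.Icc (0 : ℝ) 1 ∧ φ ∈ Set.Icc (0 : ℝ) 1 ∧
      x = fun k => Complex.exp (((2 * Real.pi * φ : ℝ) : ℂ) * Complex.I) * aVec N f k }

/-- Sums `Σ c_i` over finite decompositions `x = Σ c_i a_i`, `c_i > 0`, `a_i ∈ A`. -/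
def atomicDecomps (N : ℕ) (x : Fin N → ℂ) : Set ℝ :=
  { s | ∃ (p : ℕ) (c : Fin p → ℝ) (a : Fin p → (Fin N → ℂ)),
      (∀ i, 0 < c i) ∧ (∀ i, a i ∈ atomSet N) ∧
      (x = ∑ i, (c i : ℂ) • a i) ∧ s = ∑ i, c i }

/-- The atomic norm `‖x‖_A`. -/
def atomicNorm (N : ℕ) (x : Fin N → ℂ) : ℝ := sInf (atomicDecomps N x)

/-- The inner product `⟨u, v⟩ = Σ_k u_k conj(v_k)`. -/
def ip {N : ℕ} (u v : Fin N → ℂ) : ℂ := ∑ k, u k * (starRingEnd ℂ) (v k)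

/-- The dual atomic norm `‖z‖*_A = sup{Re⟨z,x⟩ : ‖x‖_A ≤ 1}`. -/
def dualAtomicNorm (N : ℕ) (z : Fin N → ℂ) : ℝ :=
  sSup { r : ℝ | ∃ x : Fin N → ℂ, atomicNorm N x ≤ 1 ∧ r = (ip z x).re }

/-- The Euclidean (ℓ²) norm of a complex vector. -/
def e2norm {ι : Type*} [Fintype ι] (u : ι → ℂ) : ℝ :=
  Real.sqrt (∑ k, Complex.normSq (u k))

/-- The HALS primal objective `f(h,c) = ½‖b − h − Dc‖₂² + τ‖h‖_A + (λ/2)‖c‖₂²`. -/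
def halsObj (N L : ℕ) (D : Matrix (Fin N) (Fin L) ℂ) (b : Fin N → ℂ) (τ lam : ℝ)
    (h : Fin N → ℂ) (c : Fin L → ℂ) : ℝ :=
  (1 / 2) * e2norm (b - h - D.mulVec c) ^ 2 + τ * atomicNorm N h
    + (lam / 2) * e2norm c ^ 2

/-- The HALS dual objective `g(z) = ½‖b‖₂² − ½‖b − z‖₂² − (1/(2λ))‖Dᴴz‖₂²`. -/
def halsDualObj (N L : ℕ) (D : Matrix (Fin N) (Fin L) ℂ) (b : Fin N → ℂ) (lam : ℝ)
    (z : Fin N → ℂ) : ℝ :=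
  (1 / 2) * e2norm b ^ 2 - (1 / 2) * e2norm (b - z) ^ 2
    - (1 / (2 * lam)) * e2norm (D.conjTranspose.mulVec z) ^ 2

/-- Every complex number is its norm times a phase `exp(2πi φ)` with `φ ∈ [0,1]`. -/
theorem exists_phase (t : ℂ) : ∃ φ ∈ Set.Icc (0 : ℝ) 1,
    t = (‖t‖ : ℂ) * Complex.exp (((2 * Real.pi * φ : ℝ) : ℂ) * Complex.I) := by
  refine ⟨Int.fract (t.arg / (2 * Real.pi)), ⟨Int.fract_nonneg _, (Int.fract_lt_one _).le⟩, ?_⟩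
  have hπ : (Real.pi : ℂ) ≠ 0 := by exact_mod_cast Real.pi_ne_zero
  have h : (((2 * Real.pi * Int.fract (t.arg / (2 * Real.pi)) : ℝ) : ℂ) * Complex.I)
      = t.arg * Complex.I - (⌊t.arg / (2 * Real.pi)⌋ : ℤ) * (2 * Real.pi * Complex.I) := by
    rw [Int.fract]
    push_cast
    field_simp
  rw [h, Complex.exp_sub, Complex.exp_int_mul_two_pi_mul_I, div_one, Complex.norm_mul_exp_arg_mul_I]

theorem mem_atomicDecomps_add_smul_aVec {N : ℕ} {x : Fin N → ℂ} {s f : ℝ} {t : ℂ}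
    (hs : s ∈ atomicDecomps N x) (hf : f ∈ Set.Icc (0 : ℝ) 1) (ht : t ≠ 0) :
    s + ‖t‖ ∈ atomicDecomps N (x + t • aVec N f) := by
  obtain ⟨p, c, a, hc, ha, rfl, rfl⟩ := hs
  obtain ⟨φ, hφ, hφt⟩ := exists_phase t
  refine ⟨p + 1, Fin.snoc c ‖t‖, Fin.snoc a
    (fun k => Complex.exp (((2 * Real.pi * φ : ℝ) : ℂ) * Complex.I) * aVec N f k), ?_, ?_, ?_, ?_⟩
  · intro i
    refine Fin.lastCases ?_ (fun j => ?_) i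
    · simpa using ht
    · simpa using hc j
  · intro i
    refine Fin.lastCases ?_ (fun j => ?_) i
    · rw [Fin.snoc_last]
      exact ⟨f, φ, hf, hφ, rfl⟩
    · simpa using ha j
  · rw [Fin.sum_univ_castSucc]
    simp only [Fin.snoc_castSucc, Fin.snoc_last]
    congr 1
    funext k
    simp only [Pi.smul_apply, smul_eq_mul]
    rw [← mul_assoc, ← hφt]
  · rw [Fin.sum_univ_castSucc]
    simp

theorem atomicDecomps_bddBelow (N : ℕ) (x : Fin N → ℂ) : BddBelow (atomicDecomps N x) := by
  refine ⟨0, ?_⟩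
  rintro _ ⟨p, c, a, hc, -, -, rfl⟩
  exact Finset.sum_nonneg fun i _ => (hc i).le

theorem atomicNorm_add_smul_aVec_le {N : ℕ} (x : Fin N → ℂ) (t : ℂ) {f : ℝ}
    (hf : f ∈ Set.Icc (0 : ℝ) 1) :
    atomicNorm N (x + t • aVec N f) ≤ atomicNorm N x + ‖t‖ := by
  rcases eq_or_ne t 0 with rfl | ht
  · simp
  unfold atomicNorm
  rcases (atomicDecomps N x).eq_empty_or_nonempty with hx | hx
  · have hy : atomicDecomps N (x + t • aVec N f) = ∅ := by
      by_contra hne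
      obtain ⟨s, hs⟩ := Set.nonempty_iff_ne_empty.mpr hne
      have h := mem_atomicDecomps_add_smul_aVec hs hf (neg_ne_zero.mpr ht)
      rw [neg_smul, add_neg_cancel_right, hx] at h
      exact h
    simp [hx, hy]
  · rw [← sub_le_iff_le_add]
    refine le_csInf hx fun s hs => ?_
    rw [sub_le_iff_le_add]
    exact csInf_le (atomicDecomps_bddBelow N _) (mem_atomicDecomps_add_smul_aVec hs hf ht)

theorem e2norm_sq {ι : Type*} [Fintype ι] (u : ι → ℂ) : e2norm u ^ 2 = ∑ k, ‖u k‖ ^ 2 := by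
  rw [e2norm, Real.sq_sqrt (Finset.sum_nonneg fun k _ => Complex.normSq_nonneg _)]
  simp [Complex.normSq_eq_norm_sq]

theorem e2norm_sub_single_sq {ι : Type*} [Fintype ι] [DecidableEq ι] (c : ι → ℂ) (r : ι) (t : ℂ) :
    e2norm (c - Pi.single r t) ^ 2 = e2norm c ^ 2 - ‖c r‖ ^ 2 + ‖c r - t‖ ^ 2 := by
  have h : ∑ k, (‖(c - Pi.single r t : ι → ℂ) k‖ ^ 2 - ‖c k‖ ^ 2) = ‖c r - t‖ ^ 2 - ‖c r‖ ^ 2 := by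
    rw [Fintype.sum_eq_single r]
    · simp
    · intro k hk
      simp [hk]
  rw [Finset.sum_sub_distrib] at h
  rw [e2norm_sq, e2norm_sq]
  linarith

/-- Moving the mass `t` from the coefficient `c r` into `h` leaves the residual unchanged. -/
theorem halsObj_transfer_le {N L : ℕ} (hN : 1 ≤ N) {τ lam : ℝ} (hτ : 0 ≤ τ)
    {D : Matrix (Fin N) (Fin L) ℂ}
    (hD : ∀ (k : Fin N) (r : Fin L),
      D k r = ((1 / Real.sqrt N : ℝ) : ℂ) * aVec N (((r : ℕ) : ℝ) / (L : ℝ)) k)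
    (b h : Fin N → ℂ) (c : Fin L → ℂ) (r : Fin L) (t : ℂ) :
    ∃ h', halsObj N L D b τ lam h' (c - Pi.single r t) ≤
      halsObj N L D b τ lam h c + τ * ‖t‖ + (lam / 2) * (‖c r - t‖ ^ 2 - ‖c r‖ ^ 2) := by
  have hL : (0 : ℝ) < L := by exact_mod_cast r.pos
  have hf : ((r : ℕ) : ℝ) / (L : ℝ) ∈ Set.Icc (0 : ℝ) 1 :=
    ⟨by positivity, (div_le_one hL).mpr (by exact_mod_cast r.isLt.le)⟩
  set u : ℂ := ((1 / Real.sqrt N : ℝ) : ℂ) * t with hu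
  refine ⟨h + u • aVec N (((r : ℕ) : ℝ) / (L : ℝ)), ?_⟩
  have hres : b - (h + u • aVec N (((r : ℕ) : ℝ) / (L : ℝ))) - D.mulVec (c - Pi.single r t)
      = b - h - D.mulVec c := by
    rw [Matrix.mulVec_sub]
    funext k
    simp [Matrix.mulVec_single, hD, hu]
    ring
  have hnorm : ‖u‖ ≤ ‖t‖ := by
    have hs : 1 ≤ Real.sqrt N := Real.one_le_sqrt.mpr (by exact_mod_cast hN)
    rw [hu, norm_mul, Complex.norm_real, Real.norm_of_nonneg (by positivity)]
    exact mul_le_of_le_one_left (norm_nonneg t) ((div_le_one (by positivity)).mpr hs)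
  have hatom := mul_le_mul_of_nonneg_left
    ((atomicNorm_add_smul_aVec_le h u hf).trans (add_le_add_right hnorm _)) hτ
  unfold halsObj
  rw [hres, e2norm_sub_single_sq]
  linarith

theorem norm_coeff_le_of_optimal {N L : ℕ} (hN : 1 ≤ N) {τ lam : ℝ} (hτ : 0 < τ) (hlam : 0 < lam)
    {D : Matrix (Fin N) (Fin L) ℂ}
    (hD : ∀ (k : Fin N) (r : Fin L),
      D k r = ((1 / Real.sqrt N : ℝ) : ℂ) * aVec N (((r : ℕ) : ℝ) / (L : ℝ)) k)
    {b hhat : Fin N → ℂ} {chat : Fin L → ℂ}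
    (hopt : ∀ (h : Fin N → ℂ) (c : Fin L → ℂ),
      halsObj N L D b τ lam hhat chat ≤ halsObj N L D b τ lam h c) (r : Fin L) :
    ‖chat r‖ ≤ τ / lam := by
  rw [le_div_iff₀ hlam]
  by_contra! hlt
  set x := ‖chat r‖ with hx
  have hx0 : 0 < x := pos_of_mul_pos_left (hτ.trans hlt) hlam.le
  set ε : ℝ := (x * lam - τ) / (x * lam) with hε
  have hε0 : 0 < ε := div_pos (sub_pos.mpr hlt) (by positivity)
  have hεmul : ε * (x * lam) = x * lam - τ := div_mul_cancel₀ _ (by positivity)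
  obtain ⟨h', hh'⟩ := halsObj_transfer_le (lam := lam) hN hτ.le hD b hhat chat r (ε * chat r)
  have h1 : ‖(ε : ℂ) * chat r‖ = ε * x := by
    rw [norm_mul, Complex.norm_real, Real.norm_of_nonneg hε0.le]
  have h2 : ‖chat r - (ε : ℂ) * chat r‖ ^ 2 = (1 - ε) ^ 2 * x ^ 2 := by
    rw [show chat r - (ε : ℂ) * chat r = ((1 - ε : ℝ) : ℂ) * chat r by push_cast; ring,
      norm_mul, Complex.norm_real, mul_pow, Real.norm_eq_abs, sq_abs]
  rw [h1, h2] at hh'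
  have h3 := (hopt h' _).trans hh'
  have h4 : 0 ≤ ε * x * (τ - x * lam + ε * (x * lam) / 2) := by nlinarith
  rw [hεmul] at h4
  have h5 := mul_pos hε0 hx0
  nlinarith

/-- Remark 6, energy bound on the diffuse-coefficient estimate: with the
diffuse basis matrix `D` whose `r`-th column is `(1/√N)·a(r/L)`, any primal optimal
solution `(ĥ, ĉ)` of the HALS objective satisfies `‖ĉ‖₂ ≤ √L τ / λ`. -/
theorem stmt11 (N L : ℕ) (hN : 1 ≤ N) (hL : 1 ≤ L)
    (τ lam : ℝ) (hτ : 0 < τ) (hlam : 0 < lam)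
    (D : Matrix (Fin N) (Fin L) ℂ)
    (hD : ∀ (k : Fin N) (r : Fin L),
      D k r = ((1 / Real.sqrt N : ℝ) : ℂ) * aVec N (((r : ℕ) : ℝ) / (L : ℝ)) k)
    (b : Fin N → ℂ) (hhat : Fin N → ℂ) (chat : Fin L → ℂ)
    (hopt : ∀ (h : Fin N → ℂ) (c : Fin L → ℂ),
      halsObj N L D b τ lam hhat chat ≤ halsObj N L D b τ lam h c) :
    e2norm chat ≤ Real.sqrt L * τ / lam := by
  have hbound : e2norm chat ^ 2 ≤ (Real.sqrt L * τ / lam) ^ 2 := by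
    rw [e2norm_sq, mul_div_assoc, mul_pow, Real.sq_sqrt (Nat.cast_nonneg L)]
    calc ∑ r, ‖chat r‖ ^ 2 ≤ ∑ _r : Fin L, (τ / lam) ^ 2 :=
          Finset.sum_le_sum fun r _ => pow_le_pow_left₀ (norm_nonneg _)
            (norm_coeff_le_of_optimal hN hτ hlam hD hopt r) 2
      _ = L * (τ / lam) ^ 2 := by simp
  exact (sq_le_sq₀ (Real.sqrt_nonneg _) (by positivity)).mp hbound
end
end

section
/- (Proposition 3: norm-constrained Cramér-Rao bound, Gaussian location model.) Let n ≥ 1, let Σ ∈ ℝ^{n×n} be symmetric positive definite, let V ⊆ ℝ^n be a linear subspace of dimension d ≥ 1 with orthogonal projection matrix P, let ρ > 0, and set H = {θ ∈ V : ‖θ‖₂ = ρ}. Fix θ₀ ∈ H. Let U : ℝ^n → ℝ^{n×(d−1)} be a matrix-valued map, differentiable at θ₀, such that for every θ ∈ H in some neighborhood of θ₀: P U(θ) = U(θ), θᵀ U(θ) = 0, and U(θ)ᵀ U(θ) = I_{d−1}; write U₀ = U(θ₀) and let u_k(θ) denote the k-th column of U(θ). Let T : ℝ^n → ℝ^n be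 measurable with ∫‖T(y)‖₂² dμ_θ(y) < ∞ for all θ, satisfying for every θ ∈ H: ∫‖T(y)‖₂² dμ_θ(y) = ρ² and T(y) ∈ V for μ_θ-almost every y. Define the bias b(θ) = ∫ T(y) dμ_θ(y) − θ and assume b is differentiable at θ₀ with derivative matrix B = ∇b(θ₀). Assume T is locally C-unbiased at θ₀: U₀ᵀ b(θ₀) = 0, and for each k = 1, …, d−1, u_k(θ₀)ᵀ B U₀ = − b(θ₀)ᵀ (∇u_k(θ₀)) U₀, where ∇u_k(θ₀) ∈ ℝ^{n×n} is the Jacobian of θ ↦ u_k(θ) at θ₀. Then ∫ ‖T(y) − θ₀‖₂² dμ_{θ₀}(y) ≥ 2ρ² (1 − (1 + ε/(2ρ²))^{−1/2}), where ε = 2·trace(U₀ (U₀ᵀ Σ⁻¹ U₀)⁻¹ U₀ᵀ). -/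
open scoped BigOperators
open MeasureTheory

noncomputable section

/-- The Euclidean (ℓ²) norm of a real vector. -/
def e2normR {ι : Type*} [Fintype ι] (u : ι → ℝ) : ℝ :=
  Real.sqrt (∑ k, (u k) ^ 2)

/-- The `n`-fold product of standard one-dimensional Gaussians. -/
def stdGaussianPi (n : ℕ) : Measure (Fin n → ℝ) :=
  Measure.pi fun _ => ProbabilityTheory.gaussianReal 0 1

/-- The Gaussian measure `μ_θ` on `ℝ^n` with mean `θ` and covariance `R·Rᵀ`: the
pushforward of the product of standard Gaussians under `y ↦ θ + R y`.  With `R = Σ^{1/2}`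
this is the Gaussian measure with mean `θ` and covariance `Σ`. -/
def gaussLoc (n : ℕ) (R : Matrix (Fin n) (Fin n) ℝ) (θ : Fin n → ℝ) :
    Measure (Fin n → ℝ) :=
  Measure.map (fun y => θ + R.mulVec y) (stdGaussianPi n)

lemma gaussianReal_one_eq_withDensity (v : ℝ) :
    ProbabilityTheory.gaussianReal v 1 = (ProbabilityTheory.gaussianReal 0 1).withDensity
      (fun x => ENNReal.ofReal (Real.exp (v * x - v ^ 2 / 2))) := by
  rw [ProbabilityTheory.gaussianReal_of_var_ne_zero _ one_ne_zero,
    ProbabilityTheory.gaussianReal_of_var_ne_zero _ one_ne_zero,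
    ← withDensity_mul _ (ProbabilityTheory.measurable_gaussianPDF _ _) (by fun_prop)]
  congr 1
  ext x
  simp only [ProbabilityTheory.gaussianPDF, Pi.mul_apply]
  rw [← ENNReal.ofReal_mul (ProbabilityTheory.gaussianPDFReal_nonneg _ _ _)]
  congr 1
  simp only [ProbabilityTheory.gaussianPDFReal, NNReal.coe_one, mul_one, mul_assoc]
  rw [← Real.exp_add]
  congr 2
  ring

instance (n : ℕ) : IsProbabilityMeasure (stdGaussianPi n) := by
  unfold stdGaussianPi; infer_instance

lemma integrable_exp_dotProduct {n : ℕ} (v : Fin n → ℝ) :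
    Integrable (fun z => Real.exp (v ⬝ᵥ z)) (stdGaussianPi n) := by
  simp only [dotProduct, Real.exp_sum]
  exact Integrable.fintype_prod (f := fun i x => Real.exp (v i * x))
    fun i => ProbabilityTheory.integrable_exp_mul_gaussianReal _

/-- The Cameron–Martin formula for the standard Gaussian measure on `ℝ^n`. -/
lemma map_add_stdGaussianPi {n : ℕ} (v : Fin n → ℝ) :
    (stdGaussianPi n).map (fun z => z + v) = (stdGaussianPi n).withDensity
      (fun z => ENNReal.ofReal (Real.exp (v ⬝ᵥ z - v ⬝ᵥ v / 2))) := by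
  have h1 : (stdGaussianPi n).map (fun z => z + v) =
      Measure.pi (fun i => ProbabilityTheory.gaussianReal (v i) 1) := by
    have := Measure.pi_map_pi (μ := fun _ : Fin n => ProbabilityTheory.gaussianReal 0 1)
      (f := fun i x => x + v i) (fun i => by fun_prop)
    simp only [ProbabilityTheory.gaussianReal_map_add_const, zero_add] at this
    exact this
  have hexp (z : Fin n → ℝ) : Real.exp (v ⬝ᵥ z - v ⬝ᵥ v / 2) =
      ∏ i, Real.exp (v i * z i - v i ^ 2 / 2) := by
    rw [← Real.exp_sum]
    simp only [dotProduct, Finset.sum_sub_distrib, Finset.sum_div, sq]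
  have hint (i : Fin n) : Integrable (fun x => Real.exp (v i * x - v i ^ 2 / 2))
      (ProbabilityTheory.gaussianReal 0 1) := by
    simp only [Real.exp_sub]
    exact (ProbabilityTheory.integrable_exp_mul_gaussianReal _).div_const _
  rw [h1]
  refine Measure.pi_eq fun s hs => ?_
  rw [withDensity_apply _ (MeasurableSet.univ_pi hs)]
  simp only [hexp]
  rw [stdGaussianPi, Measure.restrict_pi_pi, ← ofReal_integral_eq_lintegral_ofReal,
    integral_fintype_prod_eq_prod (fun i x => Real.exp (v i * x - v i ^ 2 / 2)),
    ENNReal.ofReal_prod_of_nonneg]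
  · refine Finset.prod_congr rfl fun i _ => ?_
    rw [gaussianReal_one_eq_withDensity (v i), withDensity_apply _ (hs i),
      ofReal_integral_eq_lintegral_ofReal (hint i).restrict]
    exact Filter.Eventually.of_forall fun x => (Real.exp_pos _).le
  · exact fun i _ => integral_nonneg fun x => (Real.exp_pos _).le
  · exact Integrable.fintype_prod (f := fun i x => Real.exp (v i * x - v i ^ 2 / 2))
      fun i => (hint i).restrict
  · exact Filter.Eventually.of_forall fun x => Finset.prod_nonneg fun _ _ => (Real.exp_pos _).le

lemma integral_add_stdGaussianPi {n : ℕ} (v : Fin n → ℝ) {g : (Fin n → ℝ) → ℝ}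
    (hg : Measurable g) :
    ∫ z, g (z + v) ∂(stdGaussianPi n) =
      ∫ z, Real.exp (v ⬝ᵥ z - v ⬝ᵥ v / 2) * g z ∂(stdGaussianPi n) := by
  rw [← integral_map (φ := fun z => z + v) (by fun_prop) hg.aestronglyMeasurable,
    map_add_stdGaussianPi, integral_withDensity_eq_integral_toReal_smul]
  · simp [ENNReal.toReal_ofReal, (Real.exp_pos _).le]
  · unfold dotProduct; fun_prop
  · simp

lemma hasDerivAt_integral_add_smul_stdGaussianPi {n : ℕ} (v : Fin n → ℝ) {g : (Fin n → ℝ) → ℝ}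
    (hg : Measurable g) (hg2 : Integrable (fun z => g z ^ 2) (stdGaussianPi n)) :
    HasDerivAt (fun t : ℝ => ∫ z, g (z + t • v) ∂(stdGaussianPi n))
      (∫ z, v ⬝ᵥ z * g z ∂(stdGaussianPi n)) 0 := by
  have hm : Measurable fun z : Fin n → ℝ => v ⬝ᵥ z := by unfold dotProduct; fun_prop
  have hc : 0 ≤ v ⬝ᵥ v := by
    exact Finset.sum_nonneg fun i _ => mul_self_nonneg (v i)
  have hg1 : Integrable g (stdGaussianPi n) :=
    ((memLp_two_iff_integrable_sq hg.aestronglyMeasurable).2 hg2).integrable (by norm_num)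
  set c := v ⬝ᵥ v with hcdef
  have hF (t : ℝ) : ∫ z, g (z + t • v) ∂(stdGaussianPi n) =
      ∫ z, Real.exp (t * (v ⬝ᵥ z) - t ^ 2 * c / 2) * g z ∂(stdGaussianPi n) := by
    rw [integral_add_stdGaussianPi _ hg]
    simp only [smul_dotProduct, dotProduct_smul, smul_eq_mul, ← hcdef]
    congr! 4
    ring
  simp only [hF]
  have key := hasDerivAt_integral_of_dominated_loc_of_deriv_le (𝕜 := ℝ)
    (μ := stdGaussianPi n) (x₀ := 0) (s := Metric.ball 0 1)
    (F := fun t z => Real.exp (t * (v ⬝ᵥ z) - t ^ 2 * c / 2) * g z)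
    (F' := fun t z => Real.exp (t * (v ⬝ᵥ z) - t ^ 2 * c / 2) * (v ⬝ᵥ z - t * c) * g z)
    (bound := fun z => g z ^ 2 + Real.exp (2 * c) *
      (Real.exp (((4 : ℝ) • v) ⬝ᵥ z) + Real.exp (((-4 : ℝ) • v) ⬝ᵥ z)))
    (Metric.ball_mem_nhds _ one_pos)
    (Filter.Eventually.of_forall fun t => by
      apply Measurable.aestronglyMeasurable; fun_prop)
    (by simpa using hg1)
    (by apply Measurable.aestronglyMeasurable; fun_prop)
    (Filter.Eventually.of_forall fun z t ht => by
      have ht' : |t| ≤ 1 := by simpa using (Metric.mem_ball.1 ht).le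
      simp only [smul_dotProduct, smul_eq_mul]
      set a := v ⬝ᵥ z
      rw [norm_mul, norm_mul, Real.norm_eq_abs, Real.norm_eq_abs, Real.norm_eq_abs,
        abs_of_pos (Real.exp_pos _)]
      have e1 : Real.exp (t * a - t ^ 2 * c / 2) ≤ Real.exp |a| := by
        apply Real.exp_le_exp.2
        have : t * a ≤ |a| := by
          calc t * a ≤ |t * a| := le_abs_self _
            _ = |t| * |a| := abs_mul _ _
            _ ≤ 1 * |a| := by gcongr
            _ = |a| := one_mul _
        have : 0 ≤ t ^ 2 * c / 2 := by positivity
        linarith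
      have e2 : |a - t * c| ≤ Real.exp (|a| + c) := by
        calc |a - t * c| ≤ |a| + |t * c| := abs_sub _ _
          _ = |a| + |t| * c := by rw [abs_mul, abs_of_nonneg hc]
          _ ≤ |a| + 1 * c := by gcongr
          _ ≤ Real.exp (|a| + c) := by linarith [Real.add_one_le_exp (|a| + c)]
      have e3 : Real.exp |a| * Real.exp (|a| + c) * |g z| ≤
          g z ^ 2 + (Real.exp |a| * Real.exp (|a| + c)) ^ 2 := by
        nlinarith [sq_nonneg (Real.exp |a| * Real.exp (|a| + c) - |g z|), sq_abs (g z),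
          sq_nonneg (g z), sq_nonneg (Real.exp |a| * Real.exp (|a| + c))]
      have e4 : (Real.exp |a| * Real.exp (|a| + c)) ^ 2 = Real.exp (2 * c) *
          Real.exp (4 * |a|) := by
        rw [← Real.exp_add, ← Real.exp_nat_mul, ← Real.exp_add]
        congr 1; push_cast; ring
      have e5 : Real.exp (4 * |a|) ≤ Real.exp (4 * a) + Real.exp (-4 * a) := by
        rcases abs_cases a with ⟨h, _⟩ | ⟨h, _⟩
        · rw [h]; linarith [Real.exp_pos (-4 * a)]
        · rw [h, show 4 * -a = -4 * a by ring]; linarith [Real.exp_pos (4 * a)]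
      calc _ ≤ Real.exp |a| * Real.exp (|a| + c) * |g z| := by gcongr
        _ ≤ _ := e3
        _ ≤ _ := by rw [e4]; gcongr)
    (hg2.add (((integrable_exp_dotProduct _).add (integrable_exp_dotProduct _)).const_mul _))
    (Filter.Eventually.of_forall fun z t _ => by
      have h := (((hasDerivAt_mul_const (v ⬝ᵥ z)).sub
        (((hasDerivAt_pow 2 t).mul_const c).div_const 2)).exp.mul_const (g z))
      refine h.congr_deriv ?_
      simp only [Nat.cast_ofNat, Nat.add_one_sub_one, pow_one, Pi.sub_apply]
      ring)
  simpa using key.2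

lemma integrable_dotProduct_sq {n : ℕ} (v : Fin n → ℝ) :
    Integrable (fun z => (v ⬝ᵥ z) ^ 2) (stdGaussianPi n) := by
  have hm : Measurable fun z : Fin n → ℝ => v ⬝ᵥ z := by unfold dotProduct; fun_prop
  refine (((integrable_exp_dotProduct v).add (integrable_exp_dotProduct (-v))).const_mul 2).mono'
    (by apply Measurable.aestronglyMeasurable; fun_prop) (Filter.Eventually.of_forall fun z => ?_)
  simp only [neg_dotProduct, Real.norm_eq_abs, abs_of_nonneg (sq_nonneg (v ⬝ᵥ z)), Pi.add_apply]
  have h := Real.quadratic_le_exp_of_nonneg (abs_nonneg (v ⬝ᵥ z))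
  have h' := sq_abs (v ⬝ᵥ z)
  rcases abs_cases (v ⬝ᵥ z) with ⟨h1, h2⟩ | ⟨h1, h2⟩
  · rw [h1] at h
    linarith [Real.exp_pos (-(v ⬝ᵥ z))]
  · rw [h1] at h
    linarith [Real.exp_pos (v ⬝ᵥ z)]

lemma integral_dotProduct_mul_dotProduct {n : ℕ} (v w : Fin n → ℝ) :
    ∫ z, v ⬝ᵥ z * w ⬝ᵥ z ∂(stdGaussianPi n) = v ⬝ᵥ w := by
  have hm : Measurable fun z : Fin n → ℝ => w ⬝ᵥ z := by unfold dotProduct; fun_prop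
  have h1 : Integrable (fun z => w ⬝ᵥ z) (stdGaussianPi n) :=
    ((memLp_two_iff_integrable_sq hm.aestronglyMeasurable).2
      (integrable_dotProduct_sq w)).integrable (by norm_num)
  refine (hasDerivAt_integral_add_smul_stdGaussianPi v hm (integrable_dotProduct_sq w)).unique ?_
  have : (fun t : ℝ => ∫ z, w ⬝ᵥ (z + t • v) ∂(stdGaussianPi n)) =
      fun t => (∫ z, w ⬝ᵥ z ∂(stdGaussianPi n)) + t * (v ⬝ᵥ w) := by
    ext t
    simp only [dotProduct_add, dotProduct_smul, smul_eq_mul]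
    rw [integral_add h1 (integrable_const _)]
    simp [dotProduct_comm w v]
  rw [this]
  exact (hasDerivAt_mul_const (v ⬝ᵥ w)).const_add _

lemma e2normR_sq {ι : Type*} [Fintype ι] (u : ι → ℝ) : e2normR u ^ 2 = u ⬝ᵥ u := by
  rw [e2normR, Real.sq_sqrt (Finset.sum_nonneg fun _ _ => sq_nonneg _)]
  simp only [dotProduct, sq]

lemma two_mul_integral_mul_sub_le_integral_sq {Ω : Type*} [MeasurableSpace Ω] {μ : Measure Ω}
    {h Z : Ω → ℝ} (hh : MemLp h 2 μ) (hZ : MemLp Z 2 μ) (a : ℝ) :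
    2 * a * ∫ x, Z x * h x ∂μ - a ^ 2 * ∫ x, Z x ^ 2 ∂μ ≤ ∫ x, h x ^ 2 ∂μ := by
  have hZh : Integrable (fun x => Z x * h x) μ := hZ.integrable_mul hh
  have h0 : 0 ≤ ∫ x, (h x - a * Z x) ^ 2 ∂μ := integral_nonneg fun x => sq_nonneg _
  have h1 : ∫ x, (h x - a * Z x) ^ 2 ∂μ =
      ∫ x, h x ^ 2 ∂μ - 2 * a * ∫ x, Z x * h x ∂μ + a ^ 2 * ∫ x, Z x ^ 2 ∂μ := by
    have hsub : Integrable (fun x => h x ^ 2 - 2 * a * (Z x * h x)) μ :=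
      hh.integrable_sq.sub (hZh.const_mul _)
    rw [← integral_const_mul, ← integral_const_mul, ← integral_sub hh.integrable_sq
      (hZh.const_mul _), ← integral_add hsub (hZ.integrable_sq.const_mul _)]
    congr 1
    ext x
    ring
  linarith

lemma sq_integral_le_integral_sq {Ω : Type*} [MeasurableSpace Ω] {μ : Measure Ω}
    [IsProbabilityMeasure μ] {h : Ω → ℝ} (hh : MemLp h 2 μ) :
    (∫ x, h x ∂μ) ^ 2 ≤ ∫ x, h x ^ 2 ∂μ := by
  have := two_mul_integral_mul_sub_le_integral_sq hh (memLp_const (1 : ℝ)) (∫ x, h x ∂μ)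
  simp only [one_mul, one_pow, integral_const, probReal_univ, smul_eq_mul, mul_one] at this
  linarith

lemma memLp_dotProduct {n : ℕ} (v : Fin n → ℝ) :
    MemLp (fun z => v ⬝ᵥ z) 2 (stdGaussianPi n) := by
  have hm : Measurable fun z : Fin n → ℝ => v ⬝ᵥ z := by unfold dotProduct; fun_prop
  exact (memLp_two_iff_integrable_sq hm.aestronglyMeasurable).2 (integrable_dotProduct_sq v)

/-- A Cramér–Rao inequality for the standard Gaussian measure: `h j` are statistics whose
correlations with the linear scores `v k ⬝ᵥ z` form the matrix `a • 1`, and `K` is the inverse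
of the Gram matrix of `v`. -/
lemma sq_mul_trace_le_sum_integral_sq {n m : ℕ} (v : Fin m → Fin n → ℝ)
    (K : Matrix (Fin m) (Fin m) ℝ) (hK : K * Matrix.of (fun j k => v j ⬝ᵥ v k) = 1)
    (h : Fin m → (Fin n → ℝ) → ℝ)
    (hh : ∀ j, MemLp (h j) 2 (stdGaussianPi n)) (a : ℝ)
    (hcov : ∀ j k, ∫ z, v k ⬝ᵥ z * h j z ∂(stdGaussianPi n) = if j = k then a else 0) :
    a ^ 2 * K.trace ≤ ∑ j, ∫ z, h j z ^ 2 ∂(stdGaussianPi n) := by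
  rw [Matrix.trace, Finset.mul_sum]
  refine Finset.sum_le_sum fun j _ => ?_
  set w : Fin n → ℝ := ∑ k, K j k • v k with hw
  have hvec (x : Fin n → ℝ) : w ⬝ᵥ x = ∑ k, K j k * (v k ⬝ᵥ x) := by
    simp only [hw, sum_dotProduct, smul_dotProduct, smul_eq_mul]
  have h1 : ∫ z, w ⬝ᵥ z * h j z ∂(stdGaussianPi n) = a * K j j := by
    simp only [hvec, Finset.sum_mul, mul_assoc]
    have hint (k : Fin m) : Integrable (fun z => K j k * (v k ⬝ᵥ z * h j z)) (stdGaussianPi n) :=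
      ((memLp_dotProduct (v k)).integrable_mul (hh j)).const_mul (K j k)
    rw [integral_finsetSum _ fun k _ => hint k]
    simp only [integral_const_mul, hcov]
    simp [mul_comm]
  have h2 : ∫ z, (w ⬝ᵥ z) ^ 2 ∂(stdGaussianPi n) = K j j := by
    simp only [sq]
    rw [integral_dotProduct_mul_dotProduct, hvec]
    have hvw (k : Fin m) : v k ⬝ᵥ w = (1 : Matrix (Fin m) (Fin m) ℝ) j k := by
      rw [dotProduct_comm, hvec, ← hK]
      simp [Matrix.mul_apply]
    simp [hvw, Matrix.one_apply]
  have := two_mul_integral_mul_sub_le_integral_sq (hh j) (memLp_dotProduct w) a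
  rw [h1, h2] at this
  simp only [Matrix.diag_apply]
  linarith

lemma sq_dotProduct_div_add_sum_sq_le {n m : ℕ} {ρ : ℝ} (hρ : 0 < ρ) {θ : Fin n → ℝ}
    (hθ : θ ⬝ᵥ θ = ρ ^ 2) {U : Matrix (Fin n) (Fin m) ℝ} (hθU : Matrix.vecMul θ U = 0)
    (hUU : U.transpose * U = 1) (x : Fin n → ℝ) :
    (θ ⬝ᵥ x) ^ 2 / ρ ^ 2 + ∑ j, (U.transpose.mulVec x j) ^ 2 ≤ x ⬝ᵥ x := by
  set q := U.transpose.mulVec x with hq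
  set c := θ ⬝ᵥ x / ρ ^ 2 with hc
  have h0 : 0 ≤ (x - c • θ - U.mulVec q) ⬝ᵥ (x - c • θ - U.mulVec q) :=
    Finset.sum_nonneg fun i _ => mul_self_nonneg _
  have e1 : θ ⬝ᵥ U.mulVec q = 0 := by rw [Matrix.dotProduct_mulVec, hθU, zero_dotProduct]
  have e2 : U.mulVec q ⬝ᵥ U.mulVec q = q ⬝ᵥ q := by
    rw [Matrix.dotProduct_mulVec, ← Matrix.mulVec_transpose, Matrix.mulVec_mulVec, hUU,
      Matrix.one_mulVec]
  have e3 : x ⬝ᵥ U.mulVec q = q ⬝ᵥ q := by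
    rw [Matrix.dotProduct_mulVec, ← Matrix.mulVec_transpose]
  have e4 : θ ⬝ᵥ x = c * ρ ^ 2 := by rw [hc]; field_simp
  have e5 : ∑ j, q j ^ 2 = q ⬝ᵥ q := by simp only [dotProduct, sq]
  simp only [sub_dotProduct, dotProduct_sub, smul_dotProduct, dotProduct_smul, smul_eq_mul,
    dotProduct_comm (U.mulVec q) x, dotProduct_comm (U.mulVec q) θ, dotProduct_comm x θ,
    e1, e2, e3, e4, hθ] at h0
  rw [e5, e4, show (c * ρ ^ 2) ^ 2 / ρ ^ 2 = c ^ 2 * ρ ^ 2 by field_simp]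
  linarith

lemma eq_smul_of_transpose_mulVec_eq_zero {n d : ℕ} (hd : 1 ≤ d) {V : Submodule ℝ (Fin n → ℝ)}
    (hdim : Module.finrank ℝ V = d) {ρ : ℝ} (hρ : 0 < ρ) {θ : Fin n → ℝ} (hθV : θ ∈ V)
    (hθ : θ ⬝ᵥ θ = ρ ^ 2) {U : Matrix (Fin n) (Fin (d - 1)) ℝ} (hθU : Matrix.vecMul θ U = 0)
    (hUU : U.transpose * U = 1) (hUV : ∀ q, U.mulVec q ∈ V) {x : Fin n → ℝ} (hx : x ∈ V)
    (hUx : U.transpose.mulVec x = 0) : x = (θ ⬝ᵥ x / ρ ^ 2) • θ := by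
  have hUθ : U.transpose.mulVec θ = 0 := by rw [Matrix.mulVec_transpose, hθU]
  let L : V →ₗ[ℝ] ℝ × (Fin (d - 1) → ℝ) :=
    ((dotProductBilin ℝ ℝ θ).prod U.transpose.mulVecLin).comp V.subtype
  have hL (y : V) : L y = (θ ⬝ᵥ (y : Fin n → ℝ), U.transpose.mulVec (y : Fin n → ℝ)) := rfl
  have hfin : Module.finrank ℝ V = Module.finrank ℝ (ℝ × (Fin (d - 1) → ℝ)) := by
    rw [hdim, Module.finrank_prod, Module.finrank_self, Module.finrank_fin_fun]
    omega
  have hsurj : Function.Surjective L := by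
    rintro ⟨c, q⟩
    refine ⟨⟨(c / ρ ^ 2) • θ + U.mulVec q, V.add_mem (V.smul_mem _ hθV) (hUV q)⟩, ?_⟩
    rw [hL]
    simp only [dotProduct_add, dotProduct_smul, hθ, Matrix.dotProduct_mulVec, hθU,
      zero_dotProduct, Matrix.mulVec_add, Matrix.mulVec_smul, hUθ, Matrix.mulVec_mulVec, hUU,
      Matrix.one_mulVec, smul_zero, zero_add, add_zero, smul_eq_mul]
    congr 1
    field_simp
  have hinj := (LinearMap.injective_iff_surjective_of_finrank_eq_finrank hfin).2 hsurj
  have := @hinj ⟨x, hx⟩ ⟨(θ ⬝ᵥ x / ρ ^ 2) • θ, V.smul_mem _ hθV⟩ (by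
    rw [hL, hL]
    simp only [dotProduct_smul, hθ, hUx, Matrix.mulVec_smul, hUθ, smul_zero, smul_eq_mul]
    congr 1
    field_simp)
  exact congrArg Subtype.val this

lemma dotProduct_mulVec_col_of_sphere_frame {n m : ℕ} {V : Submodule ℝ (Fin n → ℝ)}
    {ρ : ℝ} (hρ : 0 < ρ) {θ₀ : Fin n → ℝ} (hθ₀V : θ₀ ∈ V) (hθ₀ρ : e2normR θ₀ = ρ)
    {U : (Fin n → ℝ) → Matrix (Fin n) (Fin m) ℝ} {O : Set (Fin n → ℝ)} (hO : IsOpen O)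
    (hθ₀O : θ₀ ∈ O)
    (horth : ∀ θ ∈ O, θ ∈ V → e2normR θ = ρ → Matrix.vecMul θ (U θ) = 0)
    (hUU : (U θ₀).transpose * U θ₀ = 1) (hUV : ∀ q, (U θ₀).mulVec q ∈ V)
    {DU : Fin m → Matrix (Fin n) (Fin n) ℝ}
    (hDU : ∀ k, HasFDerivAt (fun θ : Fin n → ℝ => (fun i => U θ i k))
      (DU k).mulVecLin.toContinuousLinearMap θ₀) (k l : Fin m) :
    θ₀ ⬝ᵥ (DU k).mulVec ((U θ₀).transpose l) = -(if k = l then 1 else 0) := by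
  set u := (U θ₀).transpose l with hu
  have huV : u ∈ V := by
    have := hUV (Pi.single l 1)
    rwa [Matrix.mulVec_single_one] at this
  have hθu : θ₀ ⬝ᵥ u = 0 := congrFun (horth θ₀ hθ₀O hθ₀V hθ₀ρ) l
  have huu : u ⬝ᵥ u = 1 := by
    have := congrFun (congrFun hUU l) l
    rwa [Matrix.one_apply_eq] at this
  have hθθ : θ₀ ⬝ᵥ θ₀ = ρ ^ 2 := by rw [← e2normR_sq, hθ₀ρ]
  let c : ℝ → Fin n → ℝ := fun t => Real.cos t • θ₀ + (Real.sin t * ρ) • u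
  have hc0 : c 0 = θ₀ := by simp [c]
  have hcd : HasDerivAt c (ρ • u) 0 := by
    have h := ((Real.hasDerivAt_cos 0).smul_const θ₀).add
      (((Real.hasDerivAt_sin 0).mul_const ρ).smul_const u)
    refine h.congr_deriv ?_
    simp
  have hcV (t : ℝ) : c t ∈ V := V.add_mem (V.smul_mem _ hθ₀V) (V.smul_mem _ huV)
  have hcρ (t : ℝ) : e2normR (c t) = ρ := by
    have h1 : e2normR (c t) ^ 2 = ρ ^ 2 := by
      rw [e2normR_sq]
      simp only [c, add_dotProduct, dotProduct_add, smul_dotProduct, dotProduct_smul, smul_eq_mul,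
        dotProduct_comm u θ₀, hθu, huu, hθθ]
      linear_combination ρ ^ 2 * Real.sin_sq_add_cos_sq t
    exact (pow_left_inj₀ (Real.sqrt_nonneg _) hρ.le two_ne_zero).1 h1
  have hev : ∀ᶠ t in nhds (0 : ℝ), ∑ i, c t i * U (c t) i k = 0 := by
    filter_upwards [hcd.continuousAt.preimage_mem_nhds (hO.mem_nhds (hc0 ▸ hθ₀O))] with t ht
    exact congrFun (horth (c t) ht (hcV t) (hcρ t)) k
  have hUd : HasDerivAt (fun t => fun i => U (c t) i k) ((DU k).mulVec (ρ • u)) 0 :=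
    HasFDerivAt.comp_hasDerivAt (l := fun θ i => U θ i k)
      (l' := (DU k).mulVecLin.toContinuousLinearMap) (0 : ℝ) (by rw [hc0]; exact hDU k) hcd
  have hd : HasDerivAt (fun t => ∑ i, c t i * U (c t) i k)
      (∑ i, ((ρ • u) i * U (c 0) i k + c 0 i * (DU k).mulVec (ρ • u) i)) 0 :=
    HasDerivAt.fun_sum fun i _ => (hasDerivAt_pi.1 hcd i).mul (hasDerivAt_pi.1 hUd i)
  have h0 := hd.unique ((hasDerivAt_const (0 : ℝ) (0 : ℝ)).congr_of_eventuallyEq hev)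
  rw [hc0, Finset.sum_add_distrib] at h0
  have h1 : (ρ • u) ⬝ᵥ (U θ₀).transpose k + θ₀ ⬝ᵥ (DU k).mulVec (ρ • u) = 0 := h0
  have h2 : (U θ₀).transpose k ⬝ᵥ u = if k = l then 1 else 0 := by
    have := congrFun (congrFun hUU k) l
    rwa [Matrix.one_apply] at this
  rw [Matrix.mulVec_smul, smul_dotProduct, dotProduct_smul, dotProduct_comm u, h2, ← smul_add,
    smul_eq_mul] at h1
  have h3 := (mul_eq_zero.1 h1).resolve_left hρ.ne'
  linarith

lemma integral_gaussLoc {n : ℕ} (R : Matrix (Fin n) (Fin n) ℝ) (θ : Fin n → ℝ)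
    {f : (Fin n → ℝ) → ℝ} (hf : Measurable f) :
    ∫ y, f y ∂(gaussLoc n R θ) = ∫ z, f (θ + R.mulVec z) ∂(stdGaussianPi n) :=
  integral_map (by fun_prop) hf.aestronglyMeasurable

instance (n : ℕ) (R : Matrix (Fin n) (Fin n) ℝ) (θ : Fin n → ℝ) :
    IsProbabilityMeasure (gaussLoc n R θ) :=
  Measure.isProbabilityMeasure_map (by fun_prop)

lemma memLp_dotProduct_of_integrable_e2normR_sq {Ω : Type*} [MeasurableSpace Ω] {μ : Measure Ω}
    {n : ℕ} {T : Ω → Fin n → ℝ} (hT : Measurable T)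
    (hint : Integrable (fun y => e2normR (T y) ^ 2) μ) (p : Fin n → ℝ) :
    MemLp (fun y => p ⬝ᵥ T y) 2 μ := by
  have hi (i : Fin n) : MemLp (fun y => T y i) 2 μ := by
    have hm : Measurable fun y => T y i := by fun_prop
    refine (memLp_two_iff_integrable_sq hm.aestronglyMeasurable).2
      (hint.mono' (hm.pow_const 2).aestronglyMeasurable (Filter.Eventually.of_forall fun y => ?_))
    rw [Real.norm_eq_abs, abs_of_nonneg (sq_nonneg _), e2normR_sq, sq]
    exact Finset.single_le_sum (f := fun i => T y i * T y i) (fun i _ => mul_self_nonneg _)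
      (Finset.mem_univ i)
  exact memLp_finsetSum _ fun i _ => (hi i).const_mul (p i)

lemma dotProduct_integral {Ω : Type*} [MeasurableSpace Ω] {μ : Measure Ω} [IsFiniteMeasure μ]
    {n : ℕ} {T : Ω → Fin n → ℝ} (hT : ∀ p : Fin n → ℝ, MemLp (fun y => p ⬝ᵥ T y) 2 μ)
    (p : Fin n → ℝ) : p ⬝ᵥ ∫ y, T y ∂μ = ∫ y, p ⬝ᵥ T y ∂μ := by
  have hi (i : Fin n) : Integrable (fun y => T y i) μ := by
    have := (hT (Pi.single i 1)).integrable (by norm_num)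
    simpa only [single_dotProduct, one_mul] using this
  simp only [dotProduct]
  rw [integral_finsetSum _ fun i _ => (hi i).const_mul (p i)]
  simp only [integral_const_mul, eval_integral hi]

/-- Differentiation under the integral in the Gaussian location family: the correlation of
`p ⬝ᵥ T` with the score in direction `R v` is the directional derivative of its mean. -/
lemma integral_score_mul_eq {n : ℕ} {R : Matrix (Fin n) (Fin n) ℝ} {θ₀ : Fin n → ℝ}
    {T : (Fin n → ℝ) → (Fin n → ℝ)} (hTmeas : Measurable T)
    (hT2 : ∀ θ p, MemLp (fun y => p ⬝ᵥ T y) 2 (gaussLoc n R θ))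
    {B : Matrix (Fin n) (Fin n) ℝ}
    (hbias : HasFDerivAt (fun θ : Fin n → ℝ => (∫ y, T y ∂(gaussLoc n R θ)) - θ)
      B.mulVecLin.toContinuousLinearMap θ₀) (p v : Fin n → ℝ) :
    ∫ z, v ⬝ᵥ z * p ⬝ᵥ T (θ₀ + R.mulVec z) ∂(stdGaussianPi n) =
      p ⬝ᵥ (B.mulVec (R.mulVec v) + R.mulVec v) := by
  have hpT : Measurable fun y => p ⬝ᵥ T y := by unfold dotProduct; fun_prop
  have hg : Measurable fun z => p ⬝ᵥ T (θ₀ + R.mulVec z) := hpT.comp (by fun_prop)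
  have hg2 : Integrable (fun z => (p ⬝ᵥ T (θ₀ + R.mulVec z)) ^ 2) (stdGaussianPi n) :=
    ((hT2 θ₀ p).integrable_sq).comp_measurable (by fun_prop)
  refine (hasDerivAt_integral_add_smul_stdGaussianPi v hg hg2).unique ?_
  set w := R.mulVec v with hw
  let c : ℝ → Fin n → ℝ := fun t => θ₀ + t • w
  have hc0 : c 0 = θ₀ := by simp [c]
  have hcd : HasDerivAt c w 0 := by
    refine (((hasDerivAt_id (0 : ℝ)).smul_const w).const_add θ₀).congr_deriv ?_
    simp
  have hb : HasDerivAt (fun t => (∫ y, T y ∂(gaussLoc n R (c t))) - c t) (B.mulVec w) 0 :=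
    HasFDerivAt.comp_hasDerivAt (l := fun θ => (∫ y, T y ∂(gaussLoc n R θ)) - θ)
      (l' := B.mulVecLin.toContinuousLinearMap) (0 : ℝ) (by rw [hc0]; exact hbias) hcd
  have hm : HasDerivAt (fun t => ∫ y, T y ∂(gaussLoc n R (c t))) (B.mulVec w + w) 0 := by
    refine (hb.add hcd).congr_of_eventuallyEq (Filter.Eventually.of_forall fun t => ?_)
    simp
  have hpm : HasDerivAt (fun t => p ⬝ᵥ ∫ y, T y ∂(gaussLoc n R (c t)))
      (p ⬝ᵥ (B.mulVec w + w)) 0 :=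
    HasDerivAt.fun_sum fun i _ => (hasDerivAt_pi.1 hm i).const_mul (p i)
  refine hpm.congr_of_eventuallyEq (Filter.Eventually.of_forall fun t => ?_)
  simp only
  rw [dotProduct_integral (hT2 _), integral_gaussLoc _ _ hpT]
  simp only [c, Matrix.mulVec_add, Matrix.mulVec_smul, ← hw, add_right_comm, ← add_assoc]

/-- Proposition 3, norm-constrained Cramér–Rao bound, Gaussian location
model: under the constraint set `H = {θ ∈ V : ‖θ‖₂ = ρ}`, a locally C-unbiased
estimator `T` satisfies
`∫‖T(y) − θ₀‖₂² dμ_{θ₀}(y) ≥ 2ρ²(1 − (1 + ε/(2ρ²))^{−1/2})` with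
`ε = 2·trace(U₀(U₀ᵀΣ⁻¹U₀)⁻¹U₀ᵀ)`. -/
theorem stmt17 (n d : ℕ) (hn : 1 ≤ n) (hd : 1 ≤ d)
    (S : Matrix (Fin n) (Fin n) ℝ) (hS : S.PosDef)
    (R : Matrix (Fin n) (Fin n) ℝ) (hR : R.PosSemidef) (hRR : R * R = S)
    (V : Submodule ℝ (Fin n → ℝ)) (hdim : Module.finrank ℝ V = d)
    (P : Matrix (Fin n) (Fin n) ℝ)
    (hPsym : P.transpose = P) (hPidem : P * P = P)
    (hPmem : ∀ v : Fin n → ℝ, P.mulVec v ∈ V)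
    (hPfix : ∀ v ∈ V, P.mulVec v = v)
    (ρ : ℝ) (hρ : 0 < ρ)
    (θ₀ : Fin n → ℝ) (hθ₀V : θ₀ ∈ V) (hθ₀ρ : e2normR θ₀ = ρ)
    (U : (Fin n → ℝ) → Matrix (Fin n) (Fin (d - 1)) ℝ)
    (O : Set (Fin n → ℝ)) (hO : IsOpen O) (hθ₀O : θ₀ ∈ O)
    (hUcond : ∀ θ ∈ O, θ ∈ V → e2normR θ = ρ →
      P * U θ = U θ ∧ Matrix.vecMul θ (U θ) = 0 ∧ (U θ).transpose * U θ = 1)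
    (DU : Fin (d - 1) → Matrix (Fin n) (Fin n) ℝ)
    (hDU : ∀ k, HasFDerivAt (fun θ : Fin n → ℝ => (fun i => U θ i k))
      (DU k).mulVecLin.toContinuousLinearMap θ₀)
    (T : (Fin n → ℝ) → (Fin n → ℝ)) (hTmeas : Measurable T)
    (hTint : ∀ θ : Fin n → ℝ, Integrable (fun y => e2normR (T y) ^ 2) (gaussLoc n R θ))
    (hTnorm : ∀ θ ∈ V, e2normR θ = ρ →
      (∫ y, e2normR (T y) ^ 2 ∂(gaussLoc n R θ)) = ρ ^ 2 ∧
      (∀ᵐ y ∂(gaussLoc n R θ), T y ∈ V))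
    (B : Matrix (Fin n) (Fin n) ℝ)
    (hbias : HasFDerivAt (fun θ : Fin n → ℝ => (∫ y, T y ∂(gaussLoc n R θ)) - θ)
      B.mulVecLin.toContinuousLinearMap θ₀)
    (hCunb1 : Matrix.mulVec (U θ₀).transpose ((∫ y, T y ∂(gaussLoc n R θ₀)) - θ₀) = 0)
    (hCunb2 : ∀ k : Fin (d - 1),
      Matrix.vecMul (fun i => U θ₀ i k) (B * U θ₀) =
        - Matrix.vecMul ((∫ y, T y ∂(gaussLoc n R θ₀)) - θ₀) (DU k * U θ₀)) :
    2 * ρ ^ 2 * (1 - 1 / Real.sqrt (1 +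
      (2 * Matrix.trace (U θ₀ * ((U θ₀).transpose * S⁻¹ * U θ₀)⁻¹ * (U θ₀).transpose))
        / (2 * ρ ^ 2))) ≤
      ∫ y, e2normR (T y - θ₀) ^ 2 ∂(gaussLoc n R θ₀) := by
  have hUall := hUcond θ₀ hθ₀O hθ₀V hθ₀ρ
  obtain ⟨hPU, hθU, hUU⟩ := hUall
  set W := U θ₀ with hW
  set μ := gaussLoc n R θ₀ with hμ
  have hθθ : θ₀ ⬝ᵥ θ₀ = ρ ^ 2 := by rw [← e2normR_sq, hθ₀ρ]
  have hUV (q : Fin (d - 1) → ℝ) : W.mulVec q ∈ V := by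
    rw [← hPU, ← Matrix.mulVec_mulVec]
    exact hPmem _
  have hWW (k l : Fin (d - 1)) : W.transpose k ⬝ᵥ W.transpose l = if k = l then 1 else 0 := by
    have := congrFun (congrFun hUU k) l
    rwa [Matrix.one_apply] at this
  have hT2 (θ p : Fin n → ℝ) : MemLp (fun y => p ⬝ᵥ T y) 2 (gaussLoc n R θ) :=
    memLp_dotProduct_of_integrable_e2normR_sq hTmeas (hTint θ) p
  have hpTm (p : Fin n → ℝ) : Measurable fun y => p ⬝ᵥ T y := by unfold dotProduct; fun_prop
  obtain ⟨hT1, hTV⟩ := hTnorm θ₀ hθ₀V hθ₀ρ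
  set m₀ := ∫ y, T y ∂μ with hm₀
  have hm₀V : m₀ ∈ V := by
    have : P.mulVec m₀ = m₀ := by
      ext i
      change P i ⬝ᵥ m₀ = m₀ i
      rw [← one_mul (m₀ i), ← single_dotProduct, hm₀, dotProduct_integral (hT2 θ₀),
        dotProduct_integral (hT2 θ₀)]
      refine integral_congr_ae (hTV.mono fun y hy => ?_)
      simp only [single_dotProduct, one_mul]
      exact congrFun (hPfix _ hy) i
    rw [← this]
    exact hPmem _
  set a := θ₀ ⬝ᵥ m₀ / ρ ^ 2 with ha
  have hm₀θ : m₀ = a • θ₀ := by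
    refine eq_smul_of_transpose_mulVec_eq_zero hd hdim hρ hθ₀V hθθ hθU hUU hUV hm₀V ?_
    rw [Matrix.mulVec_sub, Matrix.mulVec_transpose W θ₀, hθU, sub_zero] at hCunb1
    exact hCunb1
  have hθm : θ₀ ⬝ᵥ m₀ = a * ρ ^ 2 := by rw [ha]; field_simp
  have hcol (k l : Fin (d - 1)) :
      W.transpose k ⬝ᵥ (B.mulVec (W.transpose l) + W.transpose l) = if k = l then a else 0 := by
    have h1 : W.transpose k ⬝ᵥ B.mulVec (W.transpose l) =
        -((m₀ - θ₀) ⬝ᵥ (DU k).mulVec (W.transpose l)) := congrFun (hCunb2 k) l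
    have h2 := dotProduct_mulVec_col_of_sphere_frame hρ hθ₀V hθ₀ρ hO hθ₀O
      (fun θ h1 h2 h3 => (hUcond θ h1 h2 h3).2.1) hUU hUV hDU k l
    rw [dotProduct_add, hWW, h1, hm₀θ, sub_dotProduct, smul_dotProduct, h2]
    split_ifs <;> simp
  have hRt : R.transpose = R := by
    rw [← Matrix.conjTranspose_eq_transpose_of_trivial]; exact hR.isHermitian
  have hRdet : IsUnit R.det := by
    have := hS.det_pos.ne'
    rw [← hRR, Matrix.det_mul] at this
    exact (left_ne_zero_of_mul this).isUnit
  let v : Fin (d - 1) → Fin n → ℝ := fun k => R⁻¹.mulVec (W.transpose k)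
  have hRv (k : Fin (d - 1)) : R.mulVec (v k) = W.transpose k := by
    simp only [v, Matrix.mulVec_mulVec, Matrix.mul_nonsing_inv _ hRdet, Matrix.one_mulVec]
  set J := W.transpose * S⁻¹ * W with hJ
  have hJv : Matrix.of (fun j k => v j ⬝ᵥ v k) = J := by
    ext j k
    rw [hJ, ← hRR, Matrix.mul_inv_rev, Matrix.mul_assoc, Matrix.mul_assoc]
    change v j ⬝ᵥ v k = W.transpose j ⬝ᵥ (fun i => (R⁻¹ * (R⁻¹ * W)) i k)
    have : (fun i => (R⁻¹ * (R⁻¹ * W)) i k) = R⁻¹.mulVec (v k) := rfl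
    rw [this, Matrix.dotProduct_mulVec (W.transpose j), ← Matrix.mulVec_transpose,
      Matrix.transpose_nonsing_inv, hRt]
  have hJpd : J.PosDef := by
    rw [hJ, ← Matrix.conjTranspose_eq_transpose_of_trivial]
    refine hS.inv.conjTranspose_mul_mul_same ?_
    intro x y hxy
    have := congrArg W.transpose.mulVec hxy
    simpa only [Matrix.mulVec_mulVec, hUU, Matrix.one_mulVec] using this
  have hJdet : IsUnit J.det := hJpd.det_pos.ne'.isUnit
  have htr : Matrix.trace (W * J⁻¹ * W.transpose) = J⁻¹.trace := by
    rw [Matrix.trace_mul_comm, ← Matrix.mul_assoc, hUU, Matrix.one_mul]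
  have hcrb : a ^ 2 * J⁻¹.trace ≤ ∑ j, ∫ y, (W.transpose.mulVec (T y) j) ^ 2 ∂μ := by
    have h := sq_mul_trace_le_sum_integral_sq v J⁻¹
      (by rw [hJv]; exact Matrix.nonsing_inv_mul _ hJdet)
      (fun j z => W.transpose j ⬝ᵥ T (θ₀ + R.mulVec z))
      (fun j => (hT2 θ₀ (W.transpose j)).comp_measurePreserving
        (Measurable.measurePreserving (by fun_prop) _)) a
      (fun j k => by
        rw [integral_score_mul_eq hTmeas hT2 hbias, hRv, hcol])
    refine h.trans_eq (Finset.sum_congr rfl fun j _ => ?_)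
    exact (integral_gaussLoc R θ₀ ((hpTm (W.transpose j)).pow_const 2)).symm
  have hθT : a ^ 2 * ρ ^ 2 ≤ (∫ y, (θ₀ ⬝ᵥ T y) ^ 2 ∂μ) / ρ ^ 2 := by
    rw [le_div_iff₀ (by positivity)]
    refine le_trans (le_of_eq ?_) (sq_integral_le_integral_sq (hT2 θ₀ θ₀))
    rw [← dotProduct_integral (hT2 θ₀), ← hm₀, hθm]
    ring
  have hbessel : (∫ y, (θ₀ ⬝ᵥ T y) ^ 2 ∂μ) / ρ ^ 2 +
      ∑ j, ∫ y, (W.transpose.mulVec (T y) j) ^ 2 ∂μ ≤ ρ ^ 2 := by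
    have hi (j : Fin (d - 1)) : Integrable (fun y => (W.transpose.mulVec (T y) j) ^ 2) μ :=
      (hT2 θ₀ (W.transpose j)).integrable_sq
    have hi0 : Integrable (fun y => (θ₀ ⬝ᵥ T y) ^ 2 / ρ ^ 2) μ :=
      (hT2 θ₀ θ₀).integrable_sq.div_const _
    have his := integrable_finsetSum Finset.univ fun j _ => hi j
    rw [← integral_div, ← integral_finsetSum _ fun j _ => hi j, ← integral_add hi0 his]
    refine (integral_mono (hi0.add his) (hTint θ₀) fun y => ?_).trans_eq hT1
    simp only [e2normR_sq]
    exact sq_dotProduct_div_add_sum_sq_le hρ hθθ hθU hUU (T y)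
  have hmse : ∫ y, e2normR (T y - θ₀) ^ 2 ∂μ = 2 * ρ ^ 2 * (1 - a) := by
    have h1 (y : Fin n → ℝ) : e2normR (T y - θ₀) ^ 2 =
        e2normR (T y) ^ 2 - 2 * (θ₀ ⬝ᵥ T y) + ρ ^ 2 := by
      rw [e2normR_sq, e2normR_sq, ← hθθ]
      simp only [sub_dotProduct, dotProduct_sub, dotProduct_comm (T y) θ₀]
      ring
    have hi1 : Integrable (fun y => 2 * (θ₀ ⬝ᵥ T y)) μ :=
      ((hT2 θ₀ θ₀).integrable (by norm_num)).const_mul 2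
    have hi2 : Integrable (fun y => e2normR (T y) ^ 2 - 2 * (θ₀ ⬝ᵥ T y)) μ := (hTint θ₀).sub hi1
    simp only [h1]
    rw [integral_add hi2 (integrable_const _), integral_sub (hTint θ₀) hi1, hT1,
      integral_const_mul, ← dotProduct_integral (hT2 θ₀), ← hm₀, hθm]
    simp
    ring
  rw [hmse, htr, mul_div_mul_left _ _ two_ne_zero]
  have hmain : a ^ 2 * (ρ ^ 2 + J⁻¹.trace) ≤ ρ ^ 2 := by linarith
  have htr0 : 0 ≤ J⁻¹.trace := hJpd.inv.posSemidef.trace_nonneg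
  have hx : 0 < 1 + J⁻¹.trace / ρ ^ 2 := by positivity
  have ha1 : a ≤ 1 / Real.sqrt (1 + J⁻¹.trace / ρ ^ 2) := by
    rw [le_div_iff₀ (Real.sqrt_pos.2 hx)]
    refine (abs_le_one_iff_mul_self_le_one.2 ?_ |> (le_abs_self _).trans)
    rw [mul_mul_mul_comm, Real.mul_self_sqrt hx.le, ← sq]
    have : a ^ 2 * (1 + J⁻¹.trace / ρ ^ 2) = a ^ 2 * (ρ ^ 2 + J⁻¹.trace) / ρ ^ 2 := by
      field_simp
    rw [this]
    exact (div_le_one (by positivity)).2 hmain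
  gcongr
end
end
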